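/- Remote reductions commute: if both a • R_{i,x} and a • R_{j,y} are defined and |i − j| ≥ 2, then a • R_{i,x}R_{j,y} and a • R_{j,y}R_{i,x} are both defined and equal. -/

import Mathlib

namespace MFR

variable {M : Type*} [Monoid M]

/-- `a` left-divides `b`. -/
def LeftDvd (a b : M) : Prop := ∃ x, a * x = b

/-- `a` right-divides `b`. -/
def RightDvd (a b : M) : Prop := ∃ x, x * a = b

/-- `m` is a right lcm of `a` and `b`. -/
def IsRightLcm (a b m : M) : Prop :=
  LeftDvd a m ∧ LeftDvd b m ∧ ∀ m', LeftDvd a m' → LeftDvd b m' → LeftDvd m m'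

/-- `m` is a left lcm of `a` and `b`. -/
def IsLeftLcm (a b m : M) : Prop :=
  RightDvd a m ∧ RightDvd b m ∧ ∀ m', RightDvd a m' → RightDvd b m' → RightDvd m m'

/-- `d` is a left gcd of `a` and `b`. -/
def IsLeftGcd (a b d : M) : Prop :=
  LeftDvd d a ∧ LeftDvd d b ∧ ∀ e, LeftDvd e a → LeftDvd e b → LeftDvd e d

/-- `d` is a right gcd of `a` and `b`. -/
def IsRightGcd (a b d : M) : Prop :=
  RightDvd d a ∧ RightDvd d b ∧ ∀ e, RightDvd e a → RightDvd e b → RightDvd e d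

/-- A gcd-monoid: cancellative, no nontrivial invertible elements,
left and right gcds exist. -/
structure IsGcdMon (M : Type*) [Monoid M] : Prop where
  mul_left_cancel : ∀ a b c : M, a * b = a * c → b = c
  mul_right_cancel : ∀ a b c : M, b * a = c * a → b = c
  unit_eq_one : ∀ a : M, IsUnit a → a = 1
  exists_leftGcd : ∀ a b : M, ∃ d, IsLeftGcd a b d
  exists_rightGcd : ∀ a b : M, ∃ d, IsRightGcd a b d

/-- Proper left divisibility: `a < b`. -/
def PLDvd (a b : M) : Prop := ∃ x, ¬ IsUnit x ∧ a * x = b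

/-- Proper right divisibility. -/
def PRDvd (a b : M) : Prop := ∃ x, ¬ IsUnit x ∧ x * a = b

/-- Noetherian: proper left and right divisibility are well-founded. -/
def Noeth (M : Type*) [Monoid M] : Prop :=
  WellFounded (PLDvd (M := M)) ∧ WellFounded (PRDvd (M := M))

/-- Proper factor relation. -/
def Factor (a b : M) : Prop := ∃ x y, x * a * y = b ∧ (¬ IsUnit x ∨ ¬ IsUnit y)

/-- Atoms: not a product of two non-invertible elements. -/
def Atomic (a : M) : Prop := ¬ IsUnit a ∧ ∀ x y, a = x * y → IsUnit x ∨ IsUnit y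

/-- Existence of a common right multiple. -/
def CommonRightMul (a b : M) : Prop := ∃ m, LeftDvd a m ∧ LeftDvd b m

/-- Existence of a common left multiple. -/
def CommonLeftMul (a b : M) : Prop := ∃ m, RightDvd a m ∧ RightDvd b m

/-- The 3-Ore condition. -/
def ThreeOre (M : Type*) [Monoid M] : Prop :=
  (∀ a b c : M, CommonRightMul a b → CommonRightMul a c → CommonRightMul b c →
    ∃ m, LeftDvd a m ∧ LeftDvd b m ∧ LeftDvd c m) ∧
  (∀ a b c : M, CommonLeftMul a b → CommonLeftMul a c → CommonLeftMul b c →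
    ∃ m, RightDvd a m ∧ RightDvd b m ∧ RightDvd c m)

/-- The product of two multifractions. -/
def fprod : List M → List M → List M
  | [], b => b
  | a, [] => a
  | a, h :: t =>
    if a.length % 2 = 1 then a.dropLast ++ ((a.getLast?.getD 1) * h) :: t
    else a ++ h :: t

/-- The congruence `≃` on multifractions generated by `(1,∅)`, `(a/a,∅)`, `(1/a/a,∅)`. -/
inductive SimEq : List M → List M → Prop
  | one : SimEq [1] []
  | divPos (a : M) : SimEq [a, a] []
  | divNeg (a : M) : SimEq [1, a, a] []
  | refl (a : List M) : SimEq a a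
  | symm {a b} : SimEq a b → SimEq b a
  | trans {a b c} : SimEq a b → SimEq b c → SimEq a c
  | mul {a b c d} : SimEq a b → SimEq c d → SimEq (fprod a c) (fprod b d)

/-- The reduction rule `R_{i,x}` on multifractions (entries indexed from 1):
`Reduce i x a b` means `b = a • R_{i,x}`. -/
def Reduce (i : ℕ) (x : M) (a b : List M) : Prop :=
  (i = 1 ∧ ∃ (a₁ a₂ b₁ b₂ : M) (s : List M),
    a = a₁ :: a₂ :: s ∧ b = b₁ :: b₂ :: s ∧ b₁ * x = a₁ ∧ b₂ * x = a₂) ∨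
  (2 ≤ i ∧ i % 2 = 0 ∧ ∃ (p s : List M) (am ai ap bi bp x' : M),
    p.length = i - 2 ∧
    a = p ++ am :: ai :: ap :: s ∧
    b = p ++ (am * x') :: bi :: bp :: s ∧
    IsRightLcm x ai (x * bi) ∧ x * bi = ai * x' ∧ x * bp = ap) ∨
  (3 ≤ i ∧ i % 2 = 1 ∧ ∃ (p s : List M) (am ai ap bi bp x' : M),
    p.length = i - 2 ∧
    a = p ++ am :: ai :: ap :: s ∧
    b = p ++ (x' * am) :: bi :: bp :: s ∧
    IsLeftLcm x ai (bi * x) ∧ bi * x = x' * ai ∧ bp * x = ap)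

/-- One-step reduction. -/
def Red (a b : List M) : Prop := ∃ i x, x ≠ (1 : M) ∧ Reduce i x a b

/-- Reflexive-transitive closure of one-step reduction. -/
def RedStar : List M → List M → Prop := Relation.ReflTransGen Red

/-- Irreducible multifractions. -/
def RIrred (a : List M) : Prop := ∀ b, ¬ Red a b

/-- Right basic elements: closure of the atoms under right complement. -/
inductive RightBasic : M → Prop
  | atom {a : M} : Atomic a → RightBasic a
  | compl {a b a' : M} : RightBasic a → RightBasic b →
      IsRightLcm a b (b * a') → RightBasic a'

/-- Minimal number of atoms needed to express `a`. -/
noncomputable def atomLen (a : M) : ℕ :=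
  sInf {n | ∃ l : List M, (∀ x ∈ l, Atomic x) ∧ l.length = n ∧ l.prod = a}


theorem split_three {p q s t : List M} {am ai ap cm cj cp : M}
    (h : p ++ am :: ai :: ap :: s = q ++ cm :: cj :: cp :: t) (hl : p.length + 2 ≤ q.length) :
    (q = p ++ [am, ai] ∧ cm = ap ∧ s = cj :: cp :: t) ∨
    ∃ r, q = p ++ am :: ai :: ap :: r ∧ s = r ++ cm :: cj :: cp :: t := by
  induction p generalizing q with
  | nil =>
    match q, hl with
    | [u, v], _ => simp at h ⊢; grind
    | u :: v :: w :: r, _ => simp at h ⊢; grind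
  | cons z p ih =>
    match q, hl with
    | u :: q, hl =>
      simp only [List.cons_append, List.cons.injEq] at h
      simp only [List.length_cons] at hl
      obtain ⟨rfl, h⟩ := h
      rcases ih h (by omega) with ⟨rfl, h'⟩ | ⟨r, rfl, h'⟩
      · exact Or.inl ⟨rfl, h'⟩
      · exact Or.inr ⟨r, rfl, h'⟩

theorem split_two {q s t : List M} {a₁ a₂ cm cj cp : M}
    (h : a₁ :: a₂ :: s = q ++ cm :: cj :: cp :: t) (hl : 1 ≤ q.length) :
    (q = [a₁] ∧ cm = a₂ ∧ s = cj :: cp :: t) ∨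
    ∃ r, q = a₁ :: a₂ :: r ∧ s = r ++ cm :: cj :: cp :: t := by
  match q, hl with
  | [u], _ => simp at h ⊢; grind
  | u :: v :: r, _ => simp at h ⊢; grind

theorem reduce_even {i : ℕ} {x : M} (p s : List M) {am ai bi bp x' : M}
    (hi : 2 ≤ i) (hp : i % 2 = 0) (hl : p.length = i - 2)
    (h1 : IsRightLcm x ai (x * bi)) (h2 : x * bi = ai * x') {a b : List M}
    (ha : a = p ++ am :: ai :: (x * bp) :: s) (hb : b = p ++ (am * x') :: bi :: bp :: s) :
    Reduce i x a b :=
  Or.inr (Or.inl ⟨hi, hp, p, s, am, ai, _, bi, bp, x', hl, ha, hb, h1, h2, rfl⟩)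

theorem reduce_odd {i : ℕ} {x : M} (p s : List M) {am ai bi bp x' : M}
    (hi : 3 ≤ i) (hp : i % 2 = 1) (hl : p.length = i - 2)
    (h1 : IsLeftLcm x ai (bi * x)) (h2 : bi * x = x' * ai) {a b : List M}
    (ha : a = p ++ am :: ai :: (bp * x) :: s) (hb : b = p ++ (x' * am) :: bi :: bp :: s) :
    Reduce i x a b :=
  Or.inr (Or.inr ⟨hi, hp, p, s, am, ai, _, bi, bp, x', hl, ha, hb, h1, h2, rfl⟩)

theorem reduce_one {x : M} (s : List M) {b₁ b₂ : M} {a b : List M}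
    (ha : a = (b₁ * x) :: (b₂ * x) :: s) (hb : b = b₁ :: b₂ :: s) :
    Reduce 1 x a b :=
  Or.inl ⟨rfl, _, _, b₁, b₂, s, ha, hb, rfl, rfl⟩

theorem remote_aux {i j : ℕ} {x y : M} {a b c : List M} (hij : i + 2 ≤ j)
    (h1 : Reduce i x a b) (h2 : Reduce j y a c) :
    ∃ d, Reduce j y b d ∧ Reduce i x c d := by
  rcases h1 with ⟨rfl, a₁, a₂, b₁, b₂, s, rfl, rfl, rfl, rfl⟩ |
    ⟨hi, pi, p, s, am, ai, ap, bi, bp, x', hl, rfl, rfl, lx, ex, rfl⟩ |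
    ⟨hi, pi, p, s, am, ai, ap, bi, bp, x', hl, rfl, rfl, lx, ex, rfl⟩ <;>
  rcases h2 with ⟨rfl, -⟩ |
    ⟨hj, pj, q, t, cm, cj, cp, dj, dp, y', hm, e, rfl, ly, ey, rfl⟩ |
    ⟨hj, pj, q, t, cm, cj, cp, dj, dp, y', hm, e, rfl, ly, ey, rfl⟩
  · omega
  · rcases split_two e (by omega) with ⟨rfl, rfl, rfl⟩ | ⟨r, rfl, rfl⟩
    · simp at hm; omega
    · exact ⟨b₁ :: b₂ :: (r ++ (cm * y') :: dj :: dp :: t),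
        reduce_even (am := cm) (bp := dp) (b₁ :: b₂ :: r) t hj pj (by simpa using hm) ly ey (by simp) (by simp),
        reduce_one _ (by simp) rfl⟩
  · rcases split_two e (by omega) with ⟨rfl, rfl, rfl⟩ | ⟨r, rfl, rfl⟩
    · exact ⟨b₁ :: (y' * b₂) :: dj :: dp :: t,
        reduce_odd (am := b₂) (bp := dp) [b₁] t hj pj (by simpa using hm) ly ey (by simp) (by simp),
        reduce_one _ (by simp [mul_assoc]) rfl⟩
    · exact ⟨b₁ :: b₂ :: (r ++ (y' * cm) :: dj :: dp :: t),
        reduce_odd (am := cm) (bp := dp) (b₁ :: b₂ :: r) t hj pj (by simpa using hm) ly ey (by simp) (by simp),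
        reduce_one _ (by simp) rfl⟩
  · omega
  · rcases split_three e (by omega) with ⟨rfl, rfl, rfl⟩ | ⟨r, rfl, rfl⟩
    · exact ⟨p ++ (am * x') :: bi :: (bp * y') :: dj :: dp :: t,
        reduce_even (am := bp) (bp := dp) (p ++ [(am * x'), bi]) t hj pj (by simpa using hm) ly ey (by simp) (by simp),
        reduce_even p _ hi pi hl lx ex (by simp [mul_assoc]) rfl⟩
    · exact ⟨p ++ (am * x') :: bi :: bp :: (r ++ (cm * y') :: dj :: dp :: t),
        reduce_even (am := cm) (bp := dp) (p ++ (am * x') :: bi :: bp :: r) t hj pj (by simpa using hm) ly ey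
          (by simp) (by simp),
        reduce_even p _ hi pi hl lx ex (by simp) rfl⟩
  · rcases split_three e (by omega) with ⟨rfl, rfl, rfl⟩ | ⟨r, rfl, rfl⟩
    · simp at hm; omega
    · exact ⟨p ++ (am * x') :: bi :: bp :: (r ++ (y' * cm) :: dj :: dp :: t),
        reduce_odd (am := cm) (bp := dp) (p ++ (am * x') :: bi :: bp :: r) t hj pj (by simpa using hm) ly ey
          (by simp) (by simp),
        reduce_even p _ hi pi hl lx ex (by simp) rfl⟩
  · omega
  · rcases split_three e (by omega) with ⟨rfl, rfl, rfl⟩ | ⟨r, rfl, rfl⟩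
    · simp at hm; omega
    · exact ⟨p ++ (x' * am) :: bi :: bp :: (r ++ (cm * y') :: dj :: dp :: t),
        reduce_even (am := cm) (bp := dp) (p ++ (x' * am) :: bi :: bp :: r) t hj pj (by simpa using hm) ly ey
          (by simp) (by simp),
        reduce_odd p _ hi pi hl lx ex (by simp) rfl⟩
  · rcases split_three e (by omega) with ⟨rfl, rfl, rfl⟩ | ⟨r, rfl, rfl⟩
    · exact ⟨p ++ (x' * am) :: bi :: (y' * bp) :: dj :: dp :: t,
        reduce_odd (am := bp) (bp := dp) (p ++ [(x' * am), bi]) t hj pj (by simpa using hm) ly ey (by simp) (by simp),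
        reduce_odd p _ hi pi hl lx ex (by simp [mul_assoc]) rfl⟩
    · exact ⟨p ++ (x' * am) :: bi :: bp :: (r ++ (y' * cm) :: dj :: dp :: t),
        reduce_odd (am := cm) (bp := dp) (p ++ (x' * am) :: bi :: bp :: r) t hj pj (by simpa using hm) ly ey
          (by simp) (by simp),
        reduce_odd p _ hi pi hl lx ex (by simp) rfl⟩

/-- remote reductions (`|i − j| ≥ 2`) commute. -/
theorem stmt_13 {M : Type*} [Monoid M] (h : IsGcdMon M) {i j : ℕ} {x y : M}
    {a b c : List M} (hij : i + 2 ≤ j ∨ j + 2 ≤ i)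
    (h1 : Reduce i x a b) (h2 : Reduce j y a c) :
    ∃ d, Reduce j y b d ∧ Reduce i x c d := by
  rcases hij with hij | hij
  · exact remote_aux hij h1 h2
  · obtain ⟨d, hd, hd'⟩ := remote_aux hij h2 h1
    exact ⟨d, hd', hd⟩

end MFR
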